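/- Let r : ℝ → ℝ be smooth, 2π-periodic (r(x+2π) = r(x) for all x), and positive (r(x) > 0 for all x). Then G(r)(x) = 0 for all x ∈ ℝ if and only if there exists a constant c ∈ ℝ such that H(r)(x) = c for all x ∈ ℝ. (The equilibria of the axisymmetric surface diffusion flow are exactly the periodic profiles of constant mean curvature.) -/

import Mathlib

open Real

/-- The (normalized) mean curvature of the surface of revolution with profile `r`. -/
noncomputable def meanCurv (r : ℝ → ℝ) (x : ℝ) : ℝ :=
  1 / (r x * Real.sqrt (1 + (deriv r x) ^ 2)) -
    deriv (deriv r) x / (1 + (deriv r x) ^ 2) ^ ((3 : ℝ) / 2)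

/-- The axisymmetric surface diffusion operator
`G(r)(x) = (1/r) ∂ₓ [ (r/√(1+r'²)) ∂ₓ H(r) ](x)`. -/
noncomputable def asdG (r : ℝ → ℝ) (x : ℝ) : ℝ :=
  (1 / r x) *
    deriv (fun y => r y / Real.sqrt (1 + (deriv r y) ^ 2) * deriv (meanCurv r) y) x

theorem ContDiff.deriv_smooth {f : ℝ → ℝ} (hf : ContDiff ℝ (⊤ : ℕ∞) f) :
    ContDiff ℝ (⊤ : ℕ∞) (deriv f) :=
  (contDiff_infty_iff_deriv.1 hf).2

theorem Function.Periodic.deriv_real {f : ℝ → ℝ} {T : ℝ} (hf : Function.Periodic f T) :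
    Function.Periodic (deriv f) T := fun x => by
  rw [← deriv_comp_add_const, hf.funext]

theorem contDiff_meanCurv {r : ℝ → ℝ} (hr : ContDiff ℝ (⊤ : ℕ∞) r) (hpos : ∀ x, 0 < r x) :
    ContDiff ℝ (⊤ : ℕ∞) (meanCurv r) := by
  have hw : ContDiff ℝ (⊤ : ℕ∞) fun x => 1 + (deriv r x) ^ 2 :=
    contDiff_const.add (hr.deriv_smooth.pow 2)
  have hw0 : ∀ x, 0 < 1 + (deriv r x) ^ 2 := fun x => by positivity
  refine ContDiff.sub (contDiff_const.div (hr.mul (hw.sqrt fun x => (hw0 x).ne')) fun x => ?_)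
    (hr.deriv_smooth.deriv_smooth.div (hw.rpow_const_of_ne fun x => (hw0 x).ne') fun x => ?_)
  · exact (mul_pos (hpos x) (Real.sqrt_pos.2 (hw0 x))).ne'
  · exact (Real.rpow_pos_of_pos (hw0 x) _).ne'

theorem periodic_meanCurv {r : ℝ → ℝ} {T : ℝ} (hr : Function.Periodic r T) :
    Function.Periodic (meanCurv r) T := fun x => by
  simp only [meanCurv, hr x, hr.deriv_real x, hr.deriv_real.deriv_real x]

/-- A periodic function whose derivative becomes constant after multiplication by a nowhere zero weight
is itself constant. -/
theorem Function.Periodic.const_of_mul_deriv_const {f p : ℝ → ℝ} {T : ℝ}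
    (hf : Function.Periodic f T) (hT : 0 < T) (hd : Differentiable ℝ f) (hp : ∀ x, p x ≠ 0)
    (h : ∀ x y, p x * deriv f x = p y * deriv f y) (x y : ℝ) : f x = f y := by
  obtain ⟨c, -, hc⟩ := exists_deriv_eq_zero hT hd.continuous.continuousOn
    (by simpa using (hf 0).symm)
  refine is_const_of_deriv_eq_zero hd (fun z => ?_) x y
  have hz := h z c
  rw [hc, mul_zero] at hz
  exact (mul_eq_zero.1 hz).resolve_left (hp z)

/-- A smooth positive `2π`-periodic profile is an equilibrium of the axisymmetric surface
diffusion flow (`G(r) ≡ 0`) if and only if it has constant mean curvature. -/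
theorem asd_equilibrium_iff_cmc (r : ℝ → ℝ)
    (hr : ContDiff ℝ (⊤ : ℕ∞) r)
    (hper : ∀ x, r (x + 2 * Real.pi) = r x)
    (hpos : ∀ x, 0 < r x) :
    (∀ x : ℝ, asdG r x = 0) ↔ ∃ c : ℝ, ∀ x : ℝ, meanCurv r x = c := by
  have hH := contDiff_meanCurv hr hpos
  have hw0 : ∀ x, 0 < 1 + (deriv r x) ^ 2 := fun x => by positivity
  have hs0 : ∀ x, 0 < Real.sqrt (1 + (deriv r x) ^ 2) := fun x => Real.sqrt_pos.2 (hw0 x)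
  constructor
  · intro h
    have hflux : ContDiff ℝ (⊤ : ℕ∞)
        fun y => r y / Real.sqrt (1 + (deriv r y) ^ 2) * deriv (meanCurv r) y :=
      (hr.div ((contDiff_const.add (hr.deriv_smooth.pow 2)).sqrt fun x => (hw0 x).ne')
        fun x => (hs0 x).ne').mul hH.deriv_smooth
    have hconst := is_const_of_deriv_eq_zero (hflux.differentiable (by simp)) fun x =>
      (mul_eq_zero.1 (h x)).resolve_left (one_div_pos.2 (hpos x)).ne'
    exact ⟨meanCurv r 0, fun x =>
      (periodic_meanCurv hper).const_of_mul_deriv_const Real.two_pi_pos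
        (hH.differentiable (by simp)) (fun x => (div_pos (hpos x) (hs0 x)).ne') hconst x 0⟩
  · rintro ⟨c, hc⟩ x
    have hconst : meanCurv r = fun _ => c := funext hc
    simp [asdG, hconst]
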